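/- Let H' be a graph such that there exists a natural number c' with χ(G) ≤ ω(G)^{c'} for every nonempty finite H'-free graph G, and let F be a star-forest. Then there exists a natural number c such that χ(G) ≤ ω(G)^{c} for every nonempty finite graph G that is free of the disjoint union of H' and F. -/

import Mathlib

open SimpleGraph

/-- `G` has no induced subgraph isomorphic to `H`. -/
def IsInducedSubgraphFree {W V : Type*} (H : SimpleGraph W) (G : SimpleGraph V) : Prop :=
  ¬ ∃ s : Set V, Nonempty (H ≃g G.induce s)

/-- `H` is a star-forest: a forest each of whose connected components is a star,
i.e. each component has a vertex adjacent to all other vertices of the component. -/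
def IsStarForest {V : Type*} (H : SimpleGraph V) : Prop :=
  H.IsAcyclic ∧ ∀ C : H.ConnectedComponent, ∃ v, H.connectedComponentMk v = C ∧
    ∀ w, H.connectedComponentMk w = C → w ≠ v → H.Adj v w

namespace SimpleGraph

section ColorableOn

variable {V : Type*} {G : SimpleGraph V}

/-- The subgraph of `G` induced on `S` has a proper colouring with `k` colours. -/
def ColorableOn (G : SimpleGraph V) (S : Finset V) (k : ℕ) : Prop :=
  ∃ f : V → ℕ, (∀ v ∈ S, f v < k) ∧ ∀ u ∈ S, ∀ v ∈ S, G.Adj u v → f u ≠ f v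

/-- The chromatic number of the subgraph of `G` induced on the finite set `S`. -/
noncomputable def chromaticNumberOn (G : SimpleGraph V) (S : Finset V) : ℕ :=
  sInf {k | G.ColorableOn S k}

theorem ColorableOn.mono_right {S : Finset V} {k l : ℕ} (h : G.ColorableOn S k) (hkl : k ≤ l) :
    G.ColorableOn S l := by
  obtain ⟨f, hf, hG⟩ := h
  exact ⟨f, fun v hv ↦ (hf v hv).trans_le hkl, hG⟩

theorem ColorableOn.mono_left {S T : Finset V} {k : ℕ} (h : G.ColorableOn T k) (hST : S ⊆ T) :
    G.ColorableOn S k := by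
  obtain ⟨f, hf, hG⟩ := h
  exact ⟨f, fun v hv ↦ hf v (hST hv), fun u hu v hv ↦ hG u (hST hu) v (hST hv)⟩

open Classical in
theorem ColorableOn.union {S T : Finset V} {k l : ℕ} (hS : G.ColorableOn S k)
    (hT : G.ColorableOn T l) : G.ColorableOn (S ∪ T) (k + l) := by
  obtain ⟨f, hf, hfG⟩ := hS
  obtain ⟨g, hg, hgG⟩ := hT
  refine ⟨fun v ↦ if v ∈ S then f v else k + g v, fun v hv ↦ ?_, fun u hu v hv huv ↦ ?_⟩
  · grind
  · have := hfG u
    have := hgG u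
    grind

theorem colorableOn_empty : G.ColorableOn ∅ 0 := ⟨fun _ ↦ 0, by simp, by simp⟩

theorem colorableOn_singleton (v : V) : G.ColorableOn {v} 1 :=
  ⟨fun _ ↦ 0, by simp, by simp⟩

open Classical in
theorem colorableOn_card (S : Finset V) : G.ColorableOn S S.card := by
  induction S using Finset.induction_on with
  | empty => exact colorableOn_empty
  | insert v S hv ih =>
    rw [Finset.card_insert_of_notMem hv, Finset.insert_eq, add_comm]
    exact (colorableOn_singleton v).union ih

theorem chromaticNumberOn_le_iff {S : Finset V} {k : ℕ} :
    G.chromaticNumberOn S ≤ k ↔ G.ColorableOn S k :=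
  ⟨fun h ↦ ColorableOn.mono_right (Nat.sInf_mem (s := {k | G.ColorableOn S k})
    ⟨_, colorableOn_card S⟩) h, fun h ↦ Nat.sInf_le h⟩

theorem colorableOn_chromaticNumberOn (S : Finset V) :
    G.ColorableOn S (G.chromaticNumberOn S) := chromaticNumberOn_le_iff.1 le_rfl

theorem chromaticNumberOn_mono {S T : Finset V} (h : S ⊆ T) :
    G.chromaticNumberOn S ≤ G.chromaticNumberOn T :=
  chromaticNumberOn_le_iff.2 ((colorableOn_chromaticNumberOn T).mono_left h)

open Classical in
theorem chromaticNumberOn_union_le (S T : Finset V) :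
    G.chromaticNumberOn (S ∪ T) ≤ G.chromaticNumberOn S + G.chromaticNumberOn T :=
  chromaticNumberOn_le_iff.2
    ((colorableOn_chromaticNumberOn S).union (colorableOn_chromaticNumberOn T))

theorem chromaticNumberOn_le_card (S : Finset V) : G.chromaticNumberOn S ≤ S.card :=
  chromaticNumberOn_le_iff.2 (colorableOn_card S)

open Classical in
theorem chromaticNumberOn_biUnion_le {ι : Type*} (I : Finset ι) (A : ι → Finset V) (b : ℕ)
    (h : ∀ i ∈ I, G.chromaticNumberOn (A i) ≤ b) :
    G.chromaticNumberOn (I.biUnion A) ≤ I.card * b := by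
  induction I using Finset.induction_on with
  | empty => simpa using chromaticNumberOn_le_card (G := G) ∅
  | insert i I hi ih =>
    rw [Finset.biUnion_insert, Finset.card_insert_of_notMem hi]
    have h1 := chromaticNumberOn_union_le (G := G) (A i) (I.biUnion A)
    have h2 := h i (by simp)
    have h3 := ih fun j hj ↦ h j (by simp [hj])
    linarith

open Classical in
/-- Greedy colouring. -/
theorem colorableOn_of_forall_card_lt {S : Finset V} {d : ℕ}
    (h : ∀ v ∈ S, (S.filter (G.Adj v)).card < d) : G.ColorableOn S d := by
  induction S using Finset.induction_on with
  | empty => exact colorableOn_empty.mono_right (Nat.zero_le _)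
  | insert v S hv ih =>
    obtain ⟨f, hf, hG⟩ := ih fun u hu ↦ lt_of_le_of_lt
      (Finset.card_le_card (Finset.filter_subset_filter _ (Finset.subset_insert _ _)))
      (h u (by simp [hu]))
    have hlt : ((S.filter (G.Adj v)).image f).card < (Finset.range d).card := by
      rw [Finset.card_range]
      exact (Finset.card_image_le.trans (Finset.card_le_card
        (Finset.filter_subset_filter _ (Finset.subset_insert _ _)))).trans_lt (h v (by simp))
    obtain ⟨c, hc, hc'⟩ := Finset.exists_mem_notMem_of_card_lt_card hlt
    have hc'' : ∀ u ∈ S, G.Adj v u → f u ≠ c := by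
      intro u hu huv hfu
      exact hc' (Finset.mem_image.2 ⟨u, by simp [hu, huv], hfu⟩)
    refine ⟨Function.update f v c, fun u hu ↦ ?_, fun u hu w hw huw ↦ ?_⟩
    · by_cases huv : u = v
      · subst huv; simpa using hc
      · rw [Function.update_of_ne huv]
        exact hf u ((Finset.mem_insert.1 hu).resolve_left huv)
    · rcases Finset.mem_insert.1 hu with hu' | hu' <;>
        rcases Finset.mem_insert.1 hw with hw' | hw'
      · exact (huw.ne (hu'.trans hw'.symm)).elim
      · rw [hu', Function.update_self, Function.update_of_ne (by rintro rfl; exact hv hw')]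
        exact (hc'' w hw' (hu' ▸ huw)).symm
      · rw [hw', Function.update_self, Function.update_of_ne (by rintro rfl; exact hv hu')]
        exact hc'' u hu' (hw' ▸ huw.symm)
      · rw [Function.update_of_ne (by rintro rfl; exact hv hu'),
          Function.update_of_ne (by rintro rfl; exact hv hw')]
        exact hG u hu' w hw' huw

open Classical in
/-- A polynomial Ramsey bound for independent sets of fixed size. -/
theorem exists_isIndepSet_of_cliqueFreeOn {n : ℕ} (hn : 1 ≤ n) (t : ℕ) {S : Finset V}
    (hS : G.CliqueFreeOn S (n + 1)) (hcard : (2 * n) ^ t ≤ S.card) :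
    ∃ L ⊆ S, L.card = t ∧ G.IsIndepSet L := by
  induction t generalizing S with
  | zero => exact ⟨∅, by simp, by simp, by simp [IsIndepSet]⟩
  | succ t ih =>
    have hpos : 1 ≤ (2 * n) ^ t := Nat.one_le_pow _ _ (by omega)
    have hSpos : 0 < S.card := lt_of_lt_of_le (by positivity) hcard
    obtain ⟨K, hK, hmax⟩ := Finset.exists_max_image
      (S.powerset.filter fun K : Finset V ↦ G.IsClique (K : Set V)) Finset.card ⟨∅, by simp⟩
    simp only [Finset.mem_filter, Finset.mem_powerset] at hK hmax
    have hKn : K.card ≤ n := by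
      by_contra! hlt
      obtain ⟨K', hK', hcard'⟩ := Finset.exists_subset_card_eq (Nat.succ_le_of_lt hlt)
      exact hS (Finset.coe_subset.2 (hK'.trans hK.1)) ⟨hK.2.subset (by simpa using hK'), hcard'⟩
    have hex : ∀ y ∈ S, ∃ x ∈ K, x = y ∨ ¬ G.Adj x y := by
      intro y hy
      by_contra! hcon
      have hyK : y ∉ K := fun h ↦ (hcon y h).1 rfl
      have := hmax (insert y K) ⟨Finset.insert_subset hy hK.1, by
        rw [Finset.coe_insert, isClique_insert]
        exact ⟨hK.2, fun b hb _ ↦ (hcon b hb).2.symm⟩⟩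
      rw [Finset.card_insert_of_notMem hyK] at this
      omega
    choose! f hfK hf using hex
    have hKne : K.Nonempty := by
      obtain ⟨y, hy⟩ := Finset.card_pos.1 hSpos
      exact ⟨_, hfK y hy⟩
    obtain ⟨x, hx, hfib⟩ := Finset.exists_le_card_fiber_of_mul_le_card_of_maps_to (s := S)
      (t := K) (f := f) (n := (2 * n) ^ t + 1) hfK hKne (by
        calc K.card * ((2 * n) ^ t + 1) ≤ n * ((2 * n) ^ t + (2 * n) ^ t) := by gcongr
          _ = (2 * n) ^ (t + 1) := by ring
          _ ≤ _ := hcard)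
    set T := (S.filter fun y ↦ f y = x).erase x with hT
    have hTS : T ⊆ S := (Finset.erase_subset _ _).trans (Finset.filter_subset _ _)
    have hTcard : (2 * n) ^ t ≤ T.card := by
      have := Finset.pred_card_le_card_erase (s := S.filter fun y ↦ f y = x) (a := x)
      rw [← hT] at this
      omega
    obtain ⟨L, hLT, hLcard, hL⟩ := ih (S := T)
      (fun K hK ↦ hS (hK.trans (Finset.coe_subset.2 hTS))) hTcard
    refine ⟨insert x L, Finset.insert_subset (hK.1 hx) (hLT.trans hTS), ?_, ?_⟩
    · rw [Finset.card_insert_of_notMem, hLcard]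
      intro h
      simpa [hT] using hLT h
    · have hxL : ∀ y ∈ L, ¬ G.Adj x y := by
        intro y hy
        have hyT := hLT hy
        simp only [hT, Finset.mem_erase, Finset.mem_filter] at hyT
        have := hf y hyT.2.1
        rw [hyT.2.2] at this
        exact this.resolve_left (Ne.symm hyT.1)
      rw [IsIndepSet, Finset.coe_insert]
      refine Set.Pairwise.insert hL fun b hb _ ↦ ⟨hxL b hb, fun h ↦ hxL b hb h.symm⟩

open Classical in
theorem exists_disjoint_cliques {j M : ℕ}
    (hM : ∀ S : Finset V, G.CliqueFreeOn S j → G.chromaticNumberOn S ≤ M) {A : Finset V} (r : ℕ)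
    (hA : M + r * j < G.chromaticNumberOn A) :
    ∃ K : ℕ → Finset V, (∀ i < r, K i ⊆ A ∧ G.IsNClique j (K i)) ∧
      ∀ i < r, ∀ l < i, Disjoint (K i) (K l) := by
  induction r with
  | zero => exact ⟨fun _ ↦ ∅, by simp, by simp⟩
  | succ r ih =>
    obtain ⟨K, hK, hdisj⟩ := ih (by nlinarith)
    set P := (Finset.range r).biUnion K
    have hP : P.card ≤ r * j := by
      simpa using Finset.card_biUnion_le_card_mul (Finset.range r) K j
        fun i hi ↦ (hK i (Finset.mem_range.1 hi)).2.card_eq.le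
    have hlt : M < G.chromaticNumberOn (A \ P) := by
      have h1 := chromaticNumberOn_union_le (G := G) (A \ P) P
      have h2 := chromaticNumberOn_le_card (G := G) P
      have h3 := chromaticNumberOn_mono (G := G) (S := A) (T := A \ P ∪ P) (by simp)
      nlinarith
    have hnot : ¬ G.CliqueFreeOn (A \ P : Finset V) j := fun h ↦ hlt.not_ge (hM _ h)
    simp only [CliqueFreeOn, not_forall, not_not] at hnot
    obtain ⟨Q, hQ, hQj⟩ := hnot
    have hQ' : Q ⊆ A \ P := Finset.coe_subset.1 hQ
    refine ⟨Function.update K r Q, fun i hi ↦ ?_, fun i hi l hl ↦ ?_⟩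
    · rcases Nat.lt_succ_iff_lt_or_eq.1 hi with hi | rfl
      · rw [Function.update_of_ne hi.ne]
        exact hK i hi
      · rw [Function.update_self]
        exact ⟨hQ'.trans Finset.sdiff_subset, hQj⟩
    · rcases Nat.lt_succ_iff_lt_or_eq.1 hi with hi | rfl
      · rw [Function.update_of_ne hi.ne, Function.update_of_ne (hl.trans hi).ne]
        exact hdisj i hi l hl
      · rw [Function.update_self, Function.update_of_ne hl.ne]
        refine (Finset.disjoint_sdiff.mono_left ?_).symm.mono_left hQ'
        exact Finset.subset_biUnion_of_mem K (Finset.mem_range.2 hl)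

end ColorableOn

section Star

variable {V : Type*} {G : SimpleGraph V}

/-- For every induced star in `G` with `t` leaves, each set of vertices outside the star with no
neighbours in the star has chromatic number at most its clique number to the power `c`. -/
def StarAnticompleteBound (G : SimpleGraph V) (t c : ℕ) : Prop :=
  ∀ (v : V) (L Q : Finset V) (n : ℕ), L.card = t → G.IsIndepSet L → (∀ x ∈ L, G.Adj v x) →
    (∀ u ∈ Q, u ≠ v ∧ ¬ G.Adj v u ∧ ∀ x ∈ L, u ≠ x ∧ ¬ G.Adj x u) →
    G.CliqueFreeOn Q (n + 1) → G.chromaticNumberOn Q ≤ n ^ c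

open Classical in
/-- If the non-neighbours of `v` have large chromatic number, then they contain a clique of
size `k`; if the neighbours of `v` have large chromatic number, then they contain many disjoint
cliques of size `n + 1 - k`, one of which is complete to the first clique. -/
theorem StarAnticompleteBound.not_lt_chromaticNumberOn {t c n k r M₁ M₂ : ℕ}
    (hG : G.StarAnticompleteBound t c) (hk1 : 1 ≤ k) (hkn : k ≤ n)
    {S A B : Finset V} {v : V} (hS : G.CliqueFreeOn S (n + 1)) (hA : A ⊆ S) (hB : B ⊆ S)
    (hvA : ∀ u ∈ A, G.Adj v u) (hvB : ∀ u ∈ B, u ≠ v ∧ ¬ G.Adj v u)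
    (hM₁ : ∀ T : Finset V, G.CliqueFreeOn T (n + 1 - k) → G.chromaticNumberOn T ≤ M₁)
    (hM₂ : ∀ T : Finset V, G.CliqueFreeOn T k → G.chromaticNumberOn T ≤ M₂)
    (hr : n * (2 * n) ^ t < r) (hchiA : M₁ + r * n < G.chromaticNumberOn A) :
    G.chromaticNumberOn B ≤ M₂ + (r * n) ^ t * n ^ c := by
  by_contra! hchiB
  obtain ⟨K, hK, hdisj⟩ := exists_disjoint_cliques hM₁ (A := A) r (lt_of_le_of_lt
    (Nat.add_le_add_left (Nat.mul_le_mul_left r (by omega)) _) hchiA)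
  set P := (Finset.range r).biUnion K with hPdef
  have hPA : P ⊆ A := by
    intro x hx
    obtain ⟨i, hi, hxi⟩ := Finset.mem_biUnion.1 hx
    exact (hK i (Finset.mem_range.1 hi)).1 hxi
  have hPcard : P.card ≤ r * n := by
    simpa using Finset.card_biUnion_le_card_mul (Finset.range r) K n
      fun i hi ↦ (hK i (Finset.mem_range.1 hi)).2.card_eq.le.trans (by omega)
  set I := (P.powersetCard t).filter fun L : Finset V ↦ G.IsIndepSet (L : Set V)
  set bad : Finset V := I.biUnion fun L ↦ B.filter fun u ↦ ∀ x ∈ L, ¬ G.Adj x u with hbad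
  have hbadchi : G.chromaticNumberOn bad ≤ (r * n) ^ t * n ^ c := by
    refine (chromaticNumberOn_biUnion_le I _ (n ^ c) fun L hL ↦ ?_).trans ?_
    · simp only [I, Finset.mem_filter, Finset.mem_powersetCard] at hL
      refine hG v L _ n hL.1.2 hL.2 (fun x hx ↦ hvA x (hPA (hL.1.1 hx))) (fun u hu ↦ ?_)
        fun T hT ↦ hS (hT.trans (Finset.coe_subset.2 ((Finset.filter_subset _ _).trans hB)))
      rw [Finset.mem_filter] at hu
      refine ⟨(hvB u hu.1).1, (hvB u hu.1).2, fun x hx ↦ ⟨?_, hu.2 x hx⟩⟩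
      rintro rfl
      exact (hvB u hu.1).2 (hvA u (hPA (hL.1.1 hx)))
    · refine Nat.mul_le_mul_right _ ((Finset.card_filter_le _ _).trans ?_)
      rw [Finset.card_powersetCard]
      exact (Nat.choose_le_pow _ _).trans (Nat.pow_le_pow_left hPcard _)
  have hgood : M₂ < G.chromaticNumberOn (B \ bad) := by
    have h1 := chromaticNumberOn_union_le (G := G) (B \ bad) bad
    have h3 := chromaticNumberOn_mono (G := G) (S := B) (T := B \ bad ∪ bad) (by simp)
    omega
  have hnot : ¬ G.CliqueFreeOn (B \ bad : Finset V) k := fun h ↦ hgood.not_ge (hM₂ _ h)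
  simp only [CliqueFreeOn, not_forall, not_not] at hnot
  obtain ⟨K', hK', hK'k⟩ := hnot
  replace hK' : K' ⊆ B \ bad := Finset.coe_subset.1 hK'
  have hK'B : K' ⊆ B := hK'.trans Finset.sdiff_subset
  set D : Finset V := K'.biUnion fun u ↦ P.filter fun x ↦ ¬ G.Adj x u with hD
  have hDcard : D.card ≤ n * (2 * n) ^ t := by
    refine (Finset.card_biUnion_le_card_mul K' _ ((2 * n) ^ t) fun u hu ↦ ?_).trans
      (Nat.mul_le_mul_right _ (hK'k.card_eq.le.trans hkn))
    by_contra! hlt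
    obtain ⟨L, hL, hLt, hLI⟩ := exists_isIndepSet_of_cliqueFreeOn (hk1.trans hkn) t
      (S := P.filter fun x ↦ ¬ G.Adj x u)
      (fun T hT ↦ hS (hT.trans (Finset.coe_subset.2
        ((Finset.filter_subset _ _).trans (hPA.trans hA))))) hlt.le
    refine (Finset.mem_sdiff.1 (hK' hu)).2 (Finset.mem_biUnion.2 ⟨L, ?_, ?_⟩)
    · simp only [I, Finset.mem_filter, Finset.mem_powersetCard]
      exact ⟨⟨hL.trans (Finset.filter_subset _ _), hLt⟩, hLI⟩
    · exact Finset.mem_filter.2 ⟨hK'B hu, fun x hx ↦ (Finset.mem_filter.1 (hL hx)).2⟩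
  have hex : ∃ i < r, Disjoint (K i) D := by
    by_contra! hcon
    have hcon' : ∀ i < r, ∃ x, x ∈ K i ∧ x ∈ D := fun i hi ↦ Finset.not_disjoint_iff.1 (hcon i hi)
    have : Nonempty V := ⟨v⟩
    choose! g hgK hgD using hcon'
    have hinj : Set.InjOn g (Finset.range r : Finset ℕ) := by
      have key : ∀ i < r, ∀ l < i, g i ≠ g l := fun i hi l hl h ↦
        Finset.disjoint_left.1 (hdisj i hi l hl) (hgK i hi) (h ▸ hgK l (hl.trans hi))
      intro i hi l hl h
      simp only [Finset.coe_range, Set.mem_Iio] at hi hl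
      rcases lt_trichotomy i l with hil | hil | hil
      · exact (key l hl i hil h.symm).elim
      · exact hil
      · exact (key i hi l hil h).elim
    have := Finset.card_le_card_of_injOn g (t := D) (fun i hi ↦ hgD i (by simpa using hi)) hinj
    rw [Finset.card_range] at this
    omega
  obtain ⟨i, hi, hiD⟩ := hex
  have hcomplete : ∀ x ∈ K i, ∀ u ∈ K', G.Adj x u := by
    intro x hx u hu
    by_contra hxu
    exact Finset.disjoint_left.1 hiD hx (Finset.mem_biUnion.2 ⟨u, hu, Finset.mem_filter.2
      ⟨Finset.mem_biUnion.2 ⟨i, Finset.mem_range.2 hi, hx⟩, hxu⟩⟩)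
  refine hS (t := K i ∪ K') (Finset.coe_subset.2
    (Finset.union_subset ((hK i hi).1.trans hA) (hK'B.trans hB))) ⟨?_, ?_⟩
  · intro x hx y hy hxy
    have hKi := (hK i hi).2.isClique
    have hKk := hK'k.isClique
    simp only [Finset.coe_union, Set.mem_union, Finset.mem_coe] at hx hy
    rcases hx with hx | hx <;> rcases hy with hy | hy
    · exact hKi hx hy hxy
    · exact hcomplete x hx y hy
    · exact (hcomplete y hy x hx).symm
    · exact hKk hx hy hxy
  · rw [Finset.card_union_of_disjoint, (hK i hi).2.card_eq, hK'k.card_eq]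
    · omega
    · refine Finset.disjoint_left.2 fun x hx hx' ↦ ?_
      exact (hvB x (hK'B hx')).2 (hvA x ((hK i hi).1 hx))

open Classical in
/-- Some vertex has a neighbourhood with chromatic number linear in that of the whole graph. -/
theorem StarAnticompleteBound.exists_le_chromaticNumberOn_neighbors {t c n : ℕ} (hn : 1 ≤ n)
    (hG : G.StarAnticompleteBound t c) {S : Finset V} (hS : G.CliqueFreeOn S (n + 1))
    (hchi : (2 * n) ^ t < G.chromaticNumberOn S) :
    ∃ v ∈ S, G.chromaticNumberOn S ≤
      n ^ c + (t + 1) + (t + 1) * G.chromaticNumberOn (S.filter (G.Adj v)) := by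
  have hdeg : ∃ v ∈ S, (2 * n) ^ t ≤ (S.filter (G.Adj v)).card := by
    by_contra! hcon
    exact hchi.not_ge (chromaticNumberOn_le_iff.2 (colorableOn_of_forall_card_lt hcon))
  obtain ⟨v, hv, hdeg⟩ := hdeg
  obtain ⟨L, hL, hLt, hLI⟩ := exists_isIndepSet_of_cliqueFreeOn hn t
    (S := S.filter (G.Adj v))
    (fun T hT ↦ hS (hT.trans (Finset.coe_subset.2 (Finset.filter_subset _ _)))) hdeg
  by_contra! hcon
  set Y := insert v L
  have hYcard : Y.card ≤ t + 1 := (Finset.card_insert_le _ _).trans (by omega)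
  set Q := S.filter fun u ↦ u ∉ Y ∧ ∀ y ∈ Y, ¬ G.Adj y u
  have hQ : G.chromaticNumberOn Q ≤ n ^ c := by
    refine hG v L Q n hLt hLI (fun x hx ↦ (Finset.mem_filter.1 (hL hx)).2) (fun u hu ↦ ?_)
      (fun T hT ↦ hS (hT.trans (Finset.coe_subset.2 (Finset.filter_subset _ _))))
    obtain ⟨-, h1, h2⟩ := Finset.mem_filter.1 hu
    refine ⟨fun h ↦ h1 (by simp [Y, h]), h2 v (by simp [Y]), fun x hx ↦
      ⟨fun h ↦ h1 (by simp [Y, h, hx]), h2 x (by simp [Y, hx])⟩⟩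
  obtain ⟨y, hy, hmax⟩ := Finset.exists_max_image Y
    (fun y ↦ G.chromaticNumberOn (S.filter (G.Adj y))) ⟨v, by simp [Y]⟩
  have hN := chromaticNumberOn_biUnion_le (G := G) Y (fun y ↦ S.filter (G.Adj y)) _ hmax
  have hsub : S ⊆ Q ∪ Y ∪ Y.biUnion fun y ↦ S.filter (G.Adj y) := by
    intro u hu
    simp only [Q, Finset.mem_union, Finset.mem_filter, Finset.mem_biUnion]
    grind
  have h1 := chromaticNumberOn_mono (G := G) hsub
  have h2 := chromaticNumberOn_union_le (G := G) (Q ∪ Y) (Y.biUnion fun y ↦ S.filter (G.Adj y))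
  have h3 := chromaticNumberOn_union_le (G := G) Q Y
  have h4 := chromaticNumberOn_le_card (G := G) Y
  have h5 := Nat.mul_le_mul_right (G.chromaticNumberOn (S.filter (G.Adj y))) hYcard
  have hYS : Y ⊆ S := Finset.insert_subset hv (hL.trans (Finset.filter_subset _ _))
  have h6 := hcon y (hYS hy)
  omega

/-- Numerical core of the induction: `a` and `b` play the role of the chromatic numbers of the
neighbourhood and the non-neighbourhood of a vertex. -/
theorem not_forall_split_of_pow_le {t q n C a b : ℕ} (hC : C = q + 2 * t + 4) (hn : 2 ≤ n)
    (hab : n ^ C ≤ a + b) (ha : n ^ C < n ^ q + (t + 1) + (t + 1) * a) (ha' : a ≤ (n - 1) ^ C) :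
    ¬ ∀ k, 1 ≤ k → k ≤ n → (n - k) ^ C + n ^ q < a → b ≤ (k - 1) ^ C + n ^ q := by
  intro hsplit
  set p := n ^ q with hp
  have hp1 : 1 ≤ p := Nat.one_le_pow _ _ (by omega)
  obtain ⟨d, hd⟩ : ∃ d, C = d + 1 := ⟨q + 2 * t + 3, hC⟩
  have hd0 : d ≠ 0 := by omega
  have hX : 4 * p < n ^ d := by
    calc 4 * p < 2 ^ 3 * p := by omega
      _ ≤ n ^ 3 * p := by gcongr
      _ = n ^ (q + 3) := by rw [hp, pow_add, mul_comm]
      _ ≤ n ^ d := Nat.pow_le_pow_right (by omega) (by omega)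
  have hdiff : ∀ k, k ≤ n → (n - k) ^ C + k * n ^ d ≤ n ^ C := by
    intro k hk
    have h1 : (n - k) ^ d ≤ n ^ d := Nat.pow_le_pow_left (by omega) _
    obtain ⟨l, rfl⟩ := Nat.exists_eq_add_of_le hk
    rw [Nat.add_sub_cancel_left] at h1 ⊢
    rw [hd, pow_succ, pow_succ]
    nlinarith
  have hb : p < b := by
    have := hdiff 1 (by omega)
    omega
  have hsum : ∀ k, 1 ≤ k → 2 * k ≤ n → (n - k) ^ C + k ^ C + 2 * p < n ^ C := by
    intro k hk hkn
    have h1 := hdiff k (by omega)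
    have h2 : 2 * k ^ d ≤ n ^ d := by
      calc 2 * k ^ d ≤ 2 ^ d * k ^ d := by gcongr; exact Nat.le_self_pow hd0 2
        _ = (2 * k) ^ d := (mul_pow _ _ _).symm
        _ ≤ n ^ d := Nat.pow_le_pow_left hkn _
    have h3 : 2 * k ^ C ≤ k * n ^ d := by
      rw [hd, pow_succ]; nlinarith
    have h4 : n ^ d ≤ k * n ^ d := Nat.le_mul_of_pos_left _ hk
    omega
  have hmid : b ≤ (n / 2 - 1) ^ C + p := by
    refine hsplit (n / 2) (by omega) (by omega) ?_
    by_contra! hle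
    set y := n - n / 2 with hy
    have hy3 : 3 * y ≤ 2 * n := by omega
    have ht : t + 1 ≤ 2 ^ t := Nat.lt_two_pow_self
    have h1 : 2 * (t + 1) * y ^ C ≤ n ^ C := by
      have e1 : 2 * (t + 1) * 2 ^ C ≤ 3 ^ C := by
        have hCt : C = 2 * (t + 1) + (q + 2) := by omega
        calc 2 * (t + 1) * 2 ^ C ≤ 2 * 2 ^ t * 2 ^ C := by gcongr
          _ = 8 ^ (t + 1) * 2 ^ (q + 2) := by
            rw [hCt, pow_add, pow_mul, show (8 : ℕ) = 2 * 2 ^ 2 by norm_num, mul_pow]; ring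
          _ ≤ 9 ^ (t + 1) * 3 ^ (q + 2) := by gcongr <;> norm_num
          _ = 3 ^ C := by rw [hCt, pow_add 3 (2 * (t + 1)), pow_mul]; norm_num
      have e2 : 3 ^ C * y ^ C ≤ 2 ^ C * n ^ C := by
        rw [← mul_pow, ← mul_pow]; exact Nat.pow_le_pow_left hy3 _
      have e3 : 0 < 2 ^ C := by positivity
      refine Nat.le_of_mul_le_mul_left ?_ e3
      calc 2 ^ C * (2 * (t + 1) * y ^ C) = (2 * (t + 1) * 2 ^ C) * y ^ C := by ring
        _ ≤ 3 ^ C * y ^ C := by gcongr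
        _ ≤ _ := e2
    have h2 : 2 * (p + (t + 1) + (t + 1) * p) ≤ n ^ C := by
      have ht' : t + 1 ≤ n ^ t := ht.trans (Nat.pow_le_pow_left hn _)
      have e1 : p + (t + 1) + (t + 1) * p ≤ 4 * (n ^ t * p) := by nlinarith
      calc 2 * (p + (t + 1) + (t + 1) * p) ≤ 2 ^ 3 * (n ^ t * p) := by omega
        _ ≤ n ^ 3 * (n ^ t * p) := by gcongr
        _ = n ^ (3 + t + q) := by rw [hp, pow_add, pow_add, mul_assoc]
        _ ≤ n ^ C := Nat.pow_le_pow_right (by omega) (by omega)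
    have h3 := Nat.mul_le_mul_left (t + 1) hle
    nlinarith
  have hex : ∃ k, b ≤ k ^ C + p := ⟨_, hmid⟩
  classical
  have hk := Nat.find_spec hex
  have hkm := Nat.find_min' hex hmid
  have hmin := fun k ↦ Nat.find_min (m := k) hex
  generalize Nat.find hex = k at hk hkm hmin
  have hk1 : 1 ≤ k := by
    by_contra! h0
    obtain rfl : k = 0 := by omega
    rw [zero_pow (by omega)] at hk
    omega
  have h1 := hsum k hk1 (by omega)
  have h2 := hmin (k - 1) (by omega)
  have h3 : ¬ (n - k) ^ C + p < a := fun h ↦ h2 (hsplit k hk1 (by omega) h)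
  omega

open Classical in
theorem StarAnticompleteBound.chromaticNumberOn_le {t c : ℕ} (hG : G.StarAnticompleteBound t c)
    (n : ℕ) (S : Finset V) (hS : G.CliqueFreeOn S (n + 1)) :
    G.chromaticNumberOn S ≤ n ^ ((2 * t + 3) * (t + 1) + c + 2 * t + 4) := by
  obtain ⟨q, hq⟩ : ∃ q, q = (2 * t + 3) * (t + 1) + c := ⟨_, rfl⟩
  obtain ⟨C, hC⟩ : ∃ C, C = q + 2 * t + 4 := ⟨_, rfl⟩
  have hcq : c ≤ q := hq ▸ Nat.le_add_left _ _
  rw [← hq, ← hC]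
  induction n using Nat.strong_induction_on generalizing S with
  | _ n ih =>
  obtain rfl | rfl | hn : n = 0 ∨ n = 1 ∨ 2 ≤ n := by omega
  · refine chromaticNumberOn_le_iff.2 ⟨fun _ ↦ 0, fun v hv ↦ ?_, fun u hu ↦ ?_⟩
    · exact (hS (t := {v}) (by simpa using hv) (by simp)).elim
    · exact (hS (t := {u}) (by simpa using hu) (by simp)).elim
  · rw [one_pow]
    refine chromaticNumberOn_le_iff.2 ⟨fun _ ↦ 0, by simp, fun u hu v hv huv ↦ ?_⟩
    refine (hS (t := {u, v}) (by simp [Set.insert_subset_iff, hu, hv]) ⟨?_, ?_⟩).elim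
    · simp [isClique_insert, huv]
    · simp [huv.ne]
  by_contra! hlt
  have h2n : (2 * n) ^ t ≤ n ^ (2 * t) := by
    rw [pow_mul]
    exact Nat.pow_le_pow_left (by nlinarith) _
  have hpow : ∀ {i j}, i ≤ j → n ^ i ≤ n ^ j := fun h ↦ Nat.pow_le_pow_right (by omega) h
  obtain ⟨v, hv, hvchi⟩ := hG.exists_le_chromaticNumberOn_neighbors (by omega) hS
    ((h2n.trans (hpow (by omega))).trans_lt hlt)
  set A := S.filter (G.Adj v)
  set B := S.filter fun u ↦ u ≠ v ∧ ¬ G.Adj v u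
  have hab : G.chromaticNumberOn S ≤ G.chromaticNumberOn A + G.chromaticNumberOn B + 1 := by
    have h1 : S ⊆ A ∪ B ∪ {v} := by
      intro u hu
      simp only [A, B, Finset.mem_union, Finset.mem_filter, Finset.mem_singleton]
      tauto
    have h2 := chromaticNumberOn_mono (G := G) h1
    have h3 := chromaticNumberOn_union_le (G := G) (A ∪ B) {v}
    have h4 := chromaticNumberOn_union_le (G := G) A B
    have h5 := chromaticNumberOn_le_card (G := G) {v}
    rw [Finset.card_singleton] at h5
    omega
  have hA : G.chromaticNumberOn A ≤ (n - 1) ^ C := by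
    refine ih (n - 1) (by omega) A fun T hT hTn ↦ ?_
    have hTA : T ⊆ A := Finset.coe_subset.1 hT
    have hadj : ∀ x ∈ T, G.Adj v x := fun x hx ↦ (Finset.mem_filter.1 (hTA hx)).2
    refine hS (t := insert v T) (Finset.coe_subset.2
      (Finset.insert_subset hv (hTA.trans (Finset.filter_subset _ _)))) ?_
    rw [Nat.sub_add_cancel (by omega)] at hTn
    exact hTn.insert hadj
  refine not_forall_split_of_pow_le (q := q) (t := t) hC hn (a := G.chromaticNumberOn A)
    (b := G.chromaticNumberOn B) (by omega) ?_ hA ?_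
  · have := hpow hcq
    omega
  · intro k hk1 hkn hk
    set r := n * (2 * n) ^ t + 1
    have hrn : r * n ≤ n ^ (2 * t + 3) := by
      calc r * n ≤ (n * n ^ (2 * t) + n * n ^ (2 * t)) * n := by
            gcongr
            have hn0 : 1 ≤ n * n ^ (2 * t) := Nat.mul_pos (by omega) (Nat.pow_pos (by omega))
            exact Nat.add_le_add (Nat.mul_le_mul_left _ h2n) hn0
        _ = 2 * (n ^ (2 * t) * n ^ 2) := by ring
        _ ≤ n * (n ^ (2 * t) * n ^ 2) := by gcongr
        _ = n ^ (2 * t + 3) := by ring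
    have hp : (r * n) ^ t * n ^ c ≤ n ^ q := by
      calc (r * n) ^ t * n ^ c ≤ (n ^ (2 * t + 3)) ^ t * n ^ c := by gcongr
        _ = n ^ ((2 * t + 3) * t + c) := by rw [← pow_mul, ← pow_add]
        _ ≤ n ^ q := hpow (by nlinarith)
    have hrn' : r * n ≤ n ^ q := hrn.trans (hpow (by nlinarith))
    have := hG.not_lt_chromaticNumberOn (r := r) (M₁ := (n - k) ^ C) (M₂ := (k - 1) ^ C) hk1 hkn hS
      (Finset.filter_subset (G.Adj v) S)
      (Finset.filter_subset (fun u ↦ u ≠ v ∧ ¬ G.Adj v u) S)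
      (fun u hu ↦ (Finset.mem_filter.1 hu).2) (fun u hu ↦ (Finset.mem_filter.1 hu).2)
      (fun T hT ↦ ih (n - k) (by omega) T (by rwa [← Nat.sub_add_comm hkn]))
      (fun T hT ↦ ih (k - 1) (by omega) T (by rwa [Nat.sub_add_cancel hk1]))
      (Nat.lt_succ_self _) (lt_of_le_of_lt (Nat.add_le_add_left hrn' _) hk)
    exact this.trans (Nat.add_le_add_left hp _)

end Star

section PolynomiallyBounded

/-- The chromatic number of `H`-free graphs is bounded by a power of the clique number. -/
def PolynomiallyChiBounding {W : Type} (H : SimpleGraph W) : Prop :=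
  ∃ c : ℕ, ∀ (V : Type) [Fintype V] (G : SimpleGraph V), Nonempty V →
    IsInducedSubgraphFree H G → G.chromaticNumber ≤ (G.cliqueNum ^ c : ℕ)

theorem isInducedSubgraphFree_iff_isEmpty_embedding {W V : Type*} {H : SimpleGraph W}
    {G : SimpleGraph V} : IsInducedSubgraphFree H G ↔ IsEmpty (H ↪g G) := by
  rw [IsInducedSubgraphFree, ← not_nonempty_iff, not_iff_not]
  constructor
  · rintro ⟨s, ⟨f⟩⟩
    exact ⟨(Embedding.induce s).comp f.toEmbedding⟩
  · rintro ⟨f⟩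
    refine ⟨Set.range f, ⟨⟨Equiv.ofInjective f f.injective, ?_⟩⟩⟩
    intro a b
    simp

theorem PolynomiallyChiBounding.of_embedding {W₁ W₂ : Type} {H₁ : SimpleGraph W₁}
    {H₂ : SimpleGraph W₂} (h : H₂.PolynomiallyChiBounding) (f : H₁ ↪g H₂) :
    H₁.PolynomiallyChiBounding := by
  obtain ⟨c, hc⟩ := h
  refine ⟨c, fun V _ G hV hG ↦ hc V G hV ?_⟩
  rw [isInducedSubgraphFree_iff_isEmpty_embedding] at hG ⊢
  exact ⟨fun g ↦ hG.false (g.comp f)⟩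

/-- The star with centre `none` and leaves `some k`. -/
def starOn (κ : Type) : SimpleGraph (Option κ) where
  Adj a b := a.isSome ≠ b.isSome
  symm := ⟨fun _ _ h ↦ h.symm⟩
  loopless := ⟨fun _ h ↦ h rfl⟩

/-- The disjoint union of copies of `starOn κ` indexed by `ι`. -/
def starUnion (ι κ : Type) : SimpleGraph (ι × Option κ) where
  Adj p q := p.1 = q.1 ∧ (starOn κ).Adj p.2 q.2
  symm := ⟨fun _ _ h ↦ ⟨h.1.symm, h.2.symm⟩⟩
  loopless := ⟨fun _ h ↦ h.2.ne rfl⟩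

theorem chromaticNumberOn_le_of_free {W : Type} {H : SimpleGraph W} {c : ℕ}
    (hc : ∀ (V : Type) [Fintype V] (G : SimpleGraph V), Nonempty V →
      IsInducedSubgraphFree H G → G.chromaticNumber ≤ (G.cliqueNum ^ c : ℕ))
    {V : Type} {G : SimpleGraph V} {Q : Finset V} {n : ℕ} (hQ : G.CliqueFreeOn Q (n + 1))
    (hfree : ∀ f : H ↪g G, ∃ w, f w ∉ Q) : G.chromaticNumberOn Q ≤ n ^ c := by
  classical
  rcases Q.eq_empty_or_nonempty with rfl | hne
  · exact (chromaticNumberOn_le_card ∅).trans (by simp)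
  set G' := G.induce (Q : Set V)
  have h1 : G'.chromaticNumber ≤ (G'.cliqueNum ^ c : ℕ) := by
    refine hc _ G' (hne.to_subtype) ?_
    rw [isInducedSubgraphFree_iff_isEmpty_embedding]
    refine ⟨fun f ↦ ?_⟩
    obtain ⟨w, hw⟩ := hfree ((Embedding.induce (Q : Set V)).comp f)
    exact hw (f w).2
  have h2 : G'.cliqueNum ≤ n := by
    by_contra! hlt
    obtain ⟨s, hs⟩ := G'.exists_isNClique_cliqueNum
    obtain ⟨T, hT, hTn⟩ := Finset.exists_subset_card_eq (s := s) (n := n + 1)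
      (by rw [hs.card_eq]; exact hlt)
    have hTG : G'.IsNClique (n + 1) T := ⟨hs.isClique.subset (Finset.coe_subset.2 hT), hTn⟩
    refine hQ (t := T.map (Function.Embedding.subtype _)) ?_ ?_
    · intro x hx
      simp only [Finset.coe_map, Set.mem_image] at hx
      obtain ⟨y, -, rfl⟩ := hx
      exact y.2
    · exact (hTG.map (f := Function.Embedding.subtype _)).mono (map_comap_le _ _)
  have h3 : G'.Colorable (n ^ c) := by
    rw [← chromaticNumber_le_iff_colorable]
    exact h1.trans (by exact_mod_cast Nat.pow_le_pow_left h2 c)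
  obtain ⟨f⟩ := h3
  refine chromaticNumberOn_le_iff.2 ⟨fun v ↦ if h : v ∈ Q then f ⟨v, h⟩ else 0, ?_, ?_⟩
  · intro v hv
    simp [hv]
  · intro u hu v hv huv
    simp only [hu, hv, dite_true]
    intro h
    exact f.valid (v := ⟨u, hu⟩) (w := ⟨v, hv⟩) huv (Fin.ext h)

theorem PolynomiallyChiBounding.sum_starOn {W : Type} {H : SimpleGraph W}
    (h : H.PolynomiallyChiBounding) (κ : Type) [Fintype κ] :
    (H ⊕g starOn κ).PolynomiallyChiBounding := by
  obtain ⟨c, hc⟩ := h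
  set t := Fintype.card κ with ht
  refine ⟨(2 * t + 3) * (t + 1) + c + 2 * t + 4, fun V _ G hV hG ↦ ?_⟩
  rw [isInducedSubgraphFree_iff_isEmpty_embedding] at hG
  have hstar : G.StarAnticompleteBound t c := by
    intro v L Q n hL hLI hvL hQ hQn
    refine chromaticNumberOn_le_of_free hc hQn fun f ↦ ?_
    by_contra! hf
    obtain ⟨e⟩ : Nonempty (κ ≃ L) := Fintype.card_eq.1 (by simp [hL, ht])
    let g : Option κ → V := fun o ↦ o.elim v fun k ↦ e k
    have hg : ∀ o, ∀ w, f w ≠ g o ∧ ¬ G.Adj (g o) (f w) := by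
      rintro (_ | k) w
      · exact ⟨(hQ _ (hf w)).1, (hQ _ (hf w)).2.1⟩
      · exact (hQ _ (hf w)).2.2 _ (e k).2
    have hgadj : ∀ a b, G.Adj (g a) (g b) ↔ (starOn κ).Adj a b := by
      rintro (_ | k) (_ | l)
      · simp [starOn]
      · simpa [starOn, g] using hvL _ (e l).2
      · simpa [starOn, g] using (hvL _ (e k).2).symm
      · simp only [starOn, Option.isSome_some, ne_eq, not_true, iff_false]
        intro hadj
        exact hLI (e k).2 (e l).2 hadj.ne hadj
    have hginj : Function.Injective g := by
      rintro (_ | k) (_ | l) h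
      · rfl
      · exact ((hvL _ (e l).2).ne h).elim
      · exact ((hvL _ (e k).2).ne h.symm).elim
      · exact congrArg some (e.injective (Subtype.ext h))
    refine hG.false ⟨⟨Sum.elim f g, ?_⟩, ?_⟩
    · exact f.injective.sumElim hginj fun w o ↦ (hg o w).1
    · rintro (a | a) (b | b)
      · simp
      · simpa using fun h ↦ (hg b a).2 h.symm
      · simpa using (hg a b).2
      · simpa using hgadj a b
  have hchi := hstar.chromaticNumberOn_le G.cliqueNum Finset.univ fun T _ hT ↦ by
    have := hT.isClique.card_le_cliqueNum
    rw [hT.card_eq] at this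
    omega
  obtain ⟨f, hf, hfG⟩ := chromaticNumberOn_le_iff.1 hchi
  rw [chromaticNumber_le_iff_colorable]
  exact ⟨Coloring.mk (fun v ↦ ⟨f v, hf v (by simp)⟩) fun {u v} huv h ↦
    hfG u (by simp) v (by simp) huv (congrArg Fin.val h)⟩

theorem PolynomiallyChiBounding.sum_starUnion {W : Type} {H : SimpleGraph W}
    (h : H.PolynomiallyChiBounding) (ι κ : Type) [Finite ι] [Fintype κ] :
    (H ⊕g starUnion ι κ).PolynomiallyChiBounding := by
  induction ι using Finite.induction_empty_option with
  | of_equiv e ih =>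
    refine ih.of_embedding (Embedding.sum Embedding.refl
      ⟨(e.symm.prodCongr (Equiv.refl _)).toEmbedding, ?_⟩)
    rintro ⟨a, x⟩ ⟨b, y⟩
    simp [starUnion]
  | h_empty =>
    refine h.of_embedding ⟨⟨Sum.elim id fun p ↦ p.1.elim, ?_⟩, ?_⟩
    · rintro (a | a) (b | b) hab
      · exact congrArg _ hab
      · exact b.1.elim
      · exact a.1.elim
      · exact a.1.elim
    · rintro (a | a) (b | b)
      · exact Iff.rfl
      · exact b.1.elim
      · exact a.1.elim
      · exact a.1.elim
  | h_option ih =>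
    rename_i ι _
    let f : W ⊕ (Option ι × Option κ) → (W ⊕ (ι × Option κ)) ⊕ Option κ
      | .inl w => .inl (.inl w)
      | .inr (some i, o) => .inl (.inr (i, o))
      | .inr (none, o) => .inr o
    have hinj : Function.Injective f := by
      rintro (a | ⟨_ | i, o⟩) (b | ⟨_ | j, o'⟩) hab <;> simp_all [f]
    have hadj : ∀ a b, ((H ⊕g starUnion ι κ) ⊕g starOn κ).Adj (f a) (f b) ↔
        (H ⊕g starUnion (Option ι) κ).Adj a b := by
      rintro (a | ⟨_ | i, o⟩) (b | ⟨_ | j, o'⟩) <;> simp [f, starUnion]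
    exact (ih.sum_starOn κ).of_embedding ⟨⟨f, hinj⟩, hadj _ _⟩

end PolynomiallyBounded

end SimpleGraph

theorem IsStarForest.nonempty_embedding_starUnion {W : Type} {F : SimpleGraph W}
    (hF : IsStarForest F) : Nonempty (F ↪g starUnion F.ConnectedComponent W) := by
  classical
  obtain ⟨hacyc, hstar⟩ := hF
  choose z hz hzadj using hstar
  let f : W → F.ConnectedComponent × Option W := fun w ↦
    (F.connectedComponentMk w, if w = z (F.connectedComponentMk w) then none else some w)
  have hinj : Function.Injective f := by
    intro a b hab
    simp only [f, Prod.mk.injEq] at hab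
    grind
  refine ⟨⟨⟨f, hinj⟩, ?_⟩⟩
  intro a b
  simp only [f, starUnion, starOn, Function.Embedding.coeFn_mk]
  constructor
  · rintro ⟨hab, hne⟩
    by_cases ha : a = z (F.connectedComponentMk a) <;>
      by_cases hb : b = z (F.connectedComponentMk b)
    · simp [← ha, ← hb] at hne
    · have := hzadj _ b hab.symm (by rwa [hab])
      rwa [← ha] at this
    · have := hzadj _ a hab (by rwa [← hab])
      rw [← hb] at this
      exact this.symm
    · simp [ha, hb] at hne
  · intro hab
    have hC : F.connectedComponentMk a = F.connectedComponentMk b :=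
      ConnectedComponent.sound hab.reachable
    refine ⟨hC, ?_⟩
    by_cases ha : a = z (F.connectedComponentMk a) <;>
      by_cases hb : b = z (F.connectedComponentMk b)
    · exact (hab.ne (by rw [ha, hb, hC])).elim
    · simp [← ha, hb]
    · simp [ha, ← hb]
    · have h1 := hzadj _ a rfl ha
      have h2 := hzadj _ b hC.symm (by rwa [hC])
      exact (hacyc.cliqueFree le_rfl _ (is3Clique_triple_iff.2 ⟨h1, h2, hab⟩)).elim

theorem stmt_5 {V' : Type} [Fintype V'] (H' : SimpleGraph V') (c' : ℕ)
    (hH' : ∀ (V : Type) [Fintype V] (G : SimpleGraph V), Nonempty V →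
      IsInducedSubgraphFree H' G → G.chromaticNumber ≤ (G.cliqueNum ^ c' : ℕ))
    {VF : Type} [Fintype VF] (F : SimpleGraph VF) (hF : IsStarForest F) :
    ∃ c : ℕ, ∀ (V : Type) [Fintype V] (G : SimpleGraph V), Nonempty V →
      IsInducedSubgraphFree (H' ⊕g F) G →
      G.chromaticNumber ≤ (G.cliqueNum ^ c : ℕ) := by
  obtain ⟨f⟩ := hF.nonempty_embedding_starUnion
  have hH : H'.PolynomiallyChiBounding := ⟨c', hH'⟩
  exact (hH.sum_starUnion F.ConnectedComponent VF).of_embedding (Embedding.sum Embedding.refl f)
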